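/- arXiv:2010.04684 — 6 statements merged into one kernel-verified Lean document; each statement's English description precedes it below -/
import Mathlib

section
/- Let v ∈ R^m be a nonzero vector and x ∈ R^m. Then there exists α* ∈ R minimizing the function α ↦ ‖x − α v‖_1 over R such that the residual x − α* v has at least one zero coordinate; equivalently, an L1-norm projection of x onto the line spanned by v can be reached using at most m − 1 unit directions. -/
open Filter Topology

/-- The average of `|a + t|` and `|a - t|` is `|a|` when `|t| ≤ |a|`. -/
theorem abs_sub_add_abs_add_of_abs_le {a t : ℝ} (h : |t| ≤ |a|) :
    |a - t| + |a + t| = 2 * |a| := by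
  grind [abs_le, abs_of_nonneg, abs_of_nonpos]

/-- A residual without zero coordinates admits a small step along which no coordinate
changes sign. -/
theorem exists_pos_forall_abs_mul_le {ι : Type*} [Finite ι] (r v : ι → ℝ)
    (hr : ∀ j, r j ≠ 0) : ∃ δ : ℝ, 0 < δ ∧ ∀ j, |δ * v j| ≤ |r j| := by
  have h : ∀ᶠ δ in 𝓝[>] (0 : ℝ), ∀ j, |δ * v j| < |r j| := by
    rw [eventually_all]
    intro j
    have hc : Continuous fun δ : ℝ => |δ * v j| := by fun_prop
    exact (hc.continuousAt.eventually_lt_const (by simpa using hr j)).filter_mono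
      nhdsWithin_le_nhds
  obtain ⟨δ, hδ, hpos⟩ := (h.and self_mem_nhdsWithin).exists
  exact ⟨δ, hpos, fun j => (hδ j).le⟩

/-- The sublevel sets of `α ↦ ‖x - α v‖₁` are compact when `v ≠ 0`. -/
theorem isCompact_setOf_sum_abs_sub_mul_le {ι : Type*} [Fintype ι] (v x : ι → ℝ)
    (hv : v ≠ 0) (c : ℝ) : IsCompact {α : ℝ | ∑ j, |x j - α * v j| ≤ c} := by
  obtain ⟨k, hk⟩ := Function.ne_iff.mp hv
  have hk' : 0 < |v k| := abs_pos.mpr hk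
  refine (isCompact_Icc (a := -((c + |x k|) / |v k|)) (b := (c + |x k|) / |v k|)).of_isClosed_subset
    (isClosed_le (by fun_prop) continuous_const) fun α hα => ?_
  have h₁ : |x k - α * v k| ≤ c :=
    (Finset.single_le_sum (f := fun j => |x j - α * v j|) (fun j _ => abs_nonneg _)
      (Finset.mem_univ k)).trans hα
  have h₂ : |α * v k| ≤ c + |x k| := by
    have := abs_sub_abs_le_abs_sub (α * v k) (x k)
    rw [abs_sub_comm] at this
    linarith
  rw [Set.mem_Icc, ← abs_le, le_div_iff₀ hk', ← abs_mul]
  exact h₂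

/-- For a nonzero `v ∈ ℝ^m` and `x ∈ ℝ^m`, there exists `α*`
minimizing `α ↦ ‖x − α v‖₁` such that the residual `x − α* v` has a zero
coordinate (the L1 projection uses at most `m − 1` unit directions). -/
theorem L1_projection_zero_residual_coordinate
    (m : ℕ) (v x : Fin m → ℝ) (hv : v ≠ 0) :
    ∃ α : ℝ,
      (∀ β : ℝ, (∑ j, |x j - α * v j|) ≤ ∑ j, |x j - β * v j|) ∧
      ∃ j : Fin m, x j - α * v j = 0 := by
  obtain ⟨α₀, hα₀, hmin⟩ := (isCompact_setOf_sum_abs_sub_mul_le v x hv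
    (∑ j, |x j - 0 * v j|)).exists_isMinOn ⟨0, Set.mem_ofPred.mpr le_rfl⟩
    (f := fun α => ∑ j, |x j - α * v j|) (by fun_prop)
  have hglobal : ∀ β : ℝ, ∑ j, |x j - α₀ * v j| ≤ ∑ j, |x j - β * v j| := fun β => by
    rcases le_total (∑ j, |x j - β * v j|) (∑ j, |x j - 0 * v j|) with h | h
    · exact hmin h
    · exact le_trans hα₀ h
  obtain ⟨α, hα, hmax⟩ := (isCompact_setOf_sum_abs_sub_mul_le v x hv
    (∑ j, |x j - α₀ * v j|)).exists_isGreatest ⟨α₀, Set.mem_ofPred.mpr le_rfl⟩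
  refine ⟨α, fun β => le_trans hα (hglobal β), ?_⟩
  by_contra! hne
  obtain ⟨δ, hδ, hstep⟩ := exists_pos_forall_abs_mul_le (fun j => x j - α * v j) v hne
  have hsum : ∑ j, |x j - (α + δ) * v j| + ∑ j, |x j - (α - δ) * v j| =
      2 * ∑ j, |x j - α * v j| := by
    rw [← Finset.sum_add_distrib, Finset.mul_sum]
    refine Finset.sum_congr rfl fun j _ => ?_
    rw [← abs_sub_add_abs_add_of_abs_le (hstep j)]
    ring_nf
  have hle : ∑ j, |x j - (α + δ) * v j| ≤ ∑ j, |x j - α₀ * v j| := by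
    have := hglobal (α - δ)
    rw [Set.mem_ofPred_eq] at hα
    linarith
  have := hmax hle
  linarith
end

section
/- Let v ∈ R^m be a nonzero vector and x ∈ R^m. Then the function α ↦ ‖x − α v‖_1 attains its global minimum over R at some point of the finite set {x_j / v_j : j with v_j ≠ 0}. -/
/-- A weighted sum of distances to finitely many points on the line is, for every `β`, at most its
value at `β` at one of these points. -/
theorem exists_sum_mul_abs_sub_le {ι : Type*} (s : Finset ι) (hs : s.Nonempty) (w r : ι → ℝ)
    (hw : ∀ k, 0 ≤ w k) (β : ℝ) :
    ∃ j ∈ s, ∑ k ∈ s, w k * |r k - r j| ≤ ∑ k ∈ s, w k * |r k - β| := by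
  rcases (s.filter (r · ≤ β)).eq_empty_or_nonempty with hl | hl
  · obtain ⟨j, hj, hmin⟩ := s.exists_min_image r hs
    refine ⟨j, hj, Finset.sum_le_sum fun k hk => mul_le_mul_of_nonneg_left ?_ (hw k)⟩
    have hβ : β < r j := not_le.mp (Finset.filter_eq_empty_iff.mp hl hj)
    have hjk := hmin k hk
    rw [abs_of_nonneg (by linarith), abs_of_nonneg (by linarith)]
    linarith
  rcases (s.filter (β ≤ r ·)).eq_empty_or_nonempty with hu | hu
  · obtain ⟨j, hj, hmax⟩ := s.exists_max_image r hs
    refine ⟨j, hj, Finset.sum_le_sum fun k hk => mul_le_mul_of_nonneg_left ?_ (hw k)⟩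
    have hβ : r j < β := not_le.mp (Finset.filter_eq_empty_iff.mp hu hj)
    have hjk := hmax k hk
    rw [abs_of_nonpos (by linarith), abs_of_nonpos (by linarith)]
    linarith
  obtain ⟨a, ha, hmax⟩ := Finset.exists_max_image _ r hl
  obtain ⟨b, hb, hmin⟩ := Finset.exists_min_image _ r hu
  simp only [Finset.mem_filter] at ha hb hmax hmin
  have affine : (r b - r a) * ∑ k ∈ s, w k * |r k - β| =
      (r b - β) * ∑ k ∈ s, w k * |r k - r a| + (β - r a) * ∑ k ∈ s, w k * |r k - r b| := by
    simp only [Finset.mul_sum, ← Finset.sum_add_distrib]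
    refine Finset.sum_congr rfl fun k hk => ?_
    rcases le_total (r k) β with h | h
    · have hka := hmax k ⟨hk, h⟩
      rw [abs_of_nonpos (by linarith), abs_of_nonpos (by linarith),
        abs_of_nonpos (by linarith)]
      ring
    · have hbk := hmin k ⟨hk, h⟩
      rw [abs_of_nonneg (by linarith), abs_of_nonneg (by linarith),
        abs_of_nonneg (by linarith)]
      ring
  by_contra! h
  have hfa := h a ha.1
  have hfb := h b hb.1
  rcases ha.2.eq_or_lt with heq | hlt
  · exact hfa.ne (by rw [heq])
  · nlinarith [mul_pos (sub_pos.mpr hlt) (sub_pos.mpr hfb),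
      mul_nonneg (sub_nonneg.mpr hb.2) (sub_pos.mpr hfa).le]

/-- For a nonzero `v ∈ ℝ^m` and `x ∈ ℝ^m`, the function
`α ↦ ‖x − α v‖₁` attains its global minimum over `ℝ` at some point of the
finite set `{x_j / v_j : v_j ≠ 0}`. -/
theorem L1_projection_attained_at_ratio
    (m : ℕ) (v x : Fin m → ℝ) (hv : v ≠ 0) :
    ∃ j : Fin m, v j ≠ 0 ∧
      ∀ β : ℝ, (∑ k, |x k - (x j / v j) * v k|) ≤ ∑ k, |x k - β * v k| := by
  classical
  set s : Finset (Fin m) := Finset.univ.filter (v · ≠ 0) with hs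
  have hne : s.Nonempty := by
    obtain ⟨j, hj⟩ := Function.ne_iff.mp hv
    exact ⟨j, by simpa [hs] using hj⟩
  have split (t : ℝ) : ∑ k, |x k - t * v k| =
      ∑ k ∈ s, |v k| * |x k / v k - t| + ∑ k with ¬ v k ≠ 0, |x k| := by
    rw [← Finset.sum_filter_add_sum_filter_not Finset.univ (v · ≠ 0)]
    congr 1
    · refine Finset.sum_congr rfl fun k hk => ?_
      have hk : v k ≠ 0 := (Finset.mem_filter.mp hk).2
      rw [← abs_mul]
      congr 1
      field_simp
    · refine Finset.sum_congr rfl fun k hk => ?_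
      have hk : v k = 0 := not_not.mp (Finset.mem_filter.mp hk).2
      simp [hk]
  obtain ⟨j, hj, hmin⟩ :=
    s.exists_min_image (fun j => ∑ k, |x k - (x j / v j) * v k|) hne
  refine ⟨j, (Finset.mem_filter.mp hj).2, fun β => ?_⟩
  obtain ⟨i, hi, hle⟩ :=
    exists_sum_mul_abs_sub_le s hne (|v ·|) (fun k => x k / v k) (fun k => abs_nonneg _) β
  refine (hmin i hi).trans ?_
  rw [split, split]
  gcongr
end

section
/- Let w_1, ..., w_n > 0, λ ≥ 0, and let r_1 ≤ r_2 ≤ ... ≤ r_n be nonzero real numbers, and define g(t) = Σ_{i=1}^n w_i |r_i − t| + λ|t|. If no index ĩ satisfies | sgn(r_ĩ) λ + Σ_{i < ĩ} w_i − Σ_{i > ĩ} w_i | ≤ w_ĩ, then t = 0 is a global minimizer of g over R. -/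
open Finset

/-- The weight strictly before position `j` minus the weight from position `j` on. -/
def weightBalance {n : ℕ} (w : Fin n → ℝ) (j : ℕ) : ℝ :=
  ∑ i : Fin n, if (i : ℕ) < j then w i else -w i

lemma weightBalance_succ {n : ℕ} (w : Fin n → ℝ) (k : Fin n) :
    weightBalance w (k + 1) = weightBalance w k + 2 * w k := by
  have h : 2 * w k = ∑ i, if i = k then 2 * w i else 0 := by simp
  rw [h, weightBalance, weightBalance, ← sum_add_distrib]
  refine sum_congr rfl fun i _ => ?_
  simp only [Fin.ext_iff]
  split_ifs <;> first | omega | ring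

lemma sum_lt_sub_sum_gt_eq_weightBalance_add {n : ℕ} (w : Fin n → ℝ) (k : Fin n) :
    (∑ i ∈ univ.filter (fun i => i < k), w i) - (∑ i ∈ univ.filter (fun i => k < i), w i)
      = weightBalance w k + w k := by
  have h : w k = ∑ i, if i = k then w i else 0 := by simp
  rw [h, weightBalance, ← sum_add_distrib, sum_filter, sum_filter, ← sum_sub_distrib]
  refine sum_congr rfl fun i _ => ?_
  simp only [Fin.ext_iff, Fin.lt_def]
  split_ifs <;> first | omega | ring

lemma weightBalance_zero_nonpos {n : ℕ} {w : Fin n → ℝ} (hw : ∀ i, 0 ≤ w i) :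
    weightBalance w 0 ≤ 0 :=
  sum_nonpos fun i _ => by simpa using hw i

lemma weightBalance_last_nonneg {n : ℕ} {w : Fin n → ℝ} (hw : ∀ i, 0 ≤ w i) :
    0 ≤ weightBalance w n :=
  sum_nonneg fun i _ => by simpa using hw i

/-- If `f` starts at or below `c` and no step among the first `m` crosses `c`, then `f m ≤ c`. -/
lemma le_of_no_crossing {f : ℕ → ℝ} {c : ℝ} {m : ℕ} (h0 : f 0 ≤ c)
    (hstep : ∀ k < m, ¬ (f k ≤ c ∧ c ≤ f (k + 1))) : f m ≤ c := by
  induction m with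
  | zero => exact h0
  | succ m ih =>
    have hm := ih fun k hk => hstep k (by omega)
    exact (not_le.1 fun h => hstep m (by omega) ⟨hm, h⟩).le

/-- If `f n` is at or above `c` and no step from `m` to `n` crosses `c`, then `c ≤ f m`. -/
lemma ge_of_no_crossing {f : ℕ → ℝ} {c : ℝ} {m n : ℕ} (hmn : m ≤ n) (hn : c ≤ f n)
    (hstep : ∀ k < n, m ≤ k → ¬ (f k ≤ c ∧ c ≤ f (k + 1))) : c ≤ f m := by
  induction hmn using Nat.decreasingInduction with
  | self => exact hn
  | of_succ k hk ih =>
    have h := ih fun l hl hkl => hstep l hl (by omega)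
    exact (not_le.1 fun hle => hstep k hk le_rfl ⟨hle, h⟩).le

/-- A sorted family of nonzero reals splits at some position into negatives, then positives. -/
lemma exists_sign_split {n : ℕ} {r : Fin n → ℝ} (hsort : Monotone r) (hr : ∀ i, r i ≠ 0) :
    ∃ m ≤ n, (∀ i : Fin n, (i : ℕ) < m → r i < 0) ∧ ∀ i : Fin n, m ≤ (i : ℕ) → 0 < r i := by
  classical
  have hex : ∃ m : ℕ, ∀ i : Fin n, m ≤ (i : ℕ) → 0 < r i := ⟨n, fun i hi => by omega⟩
  refine ⟨Nat.find hex, Nat.find_min' hex fun i hi => by omega, fun i hi => ?_, Nat.find_spec hex⟩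
  have hmin := Nat.find_min hex hi
  push Not at hmin
  obtain ⟨j, hij, hj⟩ := hmin
  exact lt_of_le_of_ne ((hsort hij).trans hj) (hr i)

/-- For positive weights `w`, penalty `λ ≥ 0`, and sorted nonzero
values `r_1 ≤ ... ≤ r_n`, if no index `itil` satisfies
`|sgn(r_itil) λ + Σ_{i < itil} w_i − Σ_{i > itil} w_i| ≤ w_itil`, then `t = 0` is a global
minimizer of `g(t) = Σ_i w_i |r_i − t| + λ|t|`. -/
theorem regularized_weighted_median_zero_optimal_of_no_index
    (n : ℕ) (w r : Fin n → ℝ) (hw : ∀ i, 0 < w i) (lam : ℝ) (hlam : 0 ≤ lam)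
    (hsort : Monotone r) (hr : ∀ i, r i ≠ 0)
    (hcond : ∀ itil : Fin n,
      ¬ (|Real.sign (r itil) * lam
          + (∑ i ∈ univ.filter (fun i => i < itil), w i)
          - (∑ i ∈ univ.filter (fun i => itil < i), w i)| ≤ w itil)) :
    ∀ t : ℝ,
      (∑ i, w i * |r i - 0|) + lam * |(0 : ℝ)| ≤ (∑ i, w i * |r i - t|) + lam * |t| := by
  have hw' : ∀ i, 0 ≤ w i := fun i => (hw i).le
  obtain ⟨m, hmn, hneg, hpos⟩ := exists_sign_split hsort hr
  have hno_crossing : ∀ k : Fin n, ¬ (weightBalance w k ≤ -(Real.sign (r k) * lam) ∧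
      -(Real.sign (r k) * lam) ≤ weightBalance w (k + 1)) := by
    rintro k ⟨h₁, h₂⟩
    refine hcond k ?_
    rw [add_sub_assoc, sum_lt_sub_sum_gt_eq_weightBalance_add, abs_le]
    rw [weightBalance_succ] at h₂
    constructor <;> linarith
  have hupper : weightBalance w m ≤ lam := by
    refine le_of_no_crossing ((weightBalance_zero_nonpos hw').trans hlam) fun k hk => ?_
    have h := hno_crossing ⟨k, by omega⟩
    rw [Real.sign_of_neg (hneg ⟨k, by omega⟩ hk)] at h
    simpa using h
  have hlower : -lam ≤ weightBalance w m := by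
    refine ge_of_no_crossing hmn ?_ fun k hkn hmk => ?_
    · linarith [weightBalance_last_nonneg hw']
    · have h := hno_crossing ⟨k, hkn⟩
      rw [Real.sign_of_pos (hpos ⟨k, hkn⟩ hmk)] at h
      simpa using h
  intro t
  have hsum : (∑ i, w i * |r i|) + weightBalance w m * t ≤ ∑ i, w i * |r i - t| := by
    rw [weightBalance, sum_mul, ← sum_add_distrib]
    refine sum_le_sum fun i _ => ?_
    split_ifs with hi
    · rw [abs_of_neg (hneg i hi)]
      linarith [mul_le_mul_of_nonneg_left (neg_le_abs (r i - t)) (hw' i)]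
    · rw [abs_of_pos (hpos i (not_lt.1 hi))]
      linarith [mul_le_mul_of_nonneg_left (le_abs_self (r i - t)) (hw' i)]
  have hpenalty : -(lam * |t|) ≤ weightBalance w m * t := by
    have h := mul_le_mul_of_nonneg_right (abs_le.2 ⟨hlower, hupper⟩) (abs_nonneg t)
    rw [← abs_mul] at h
    exact (abs_le.1 h).1
  simp only [sub_zero, abs_zero, mul_zero, add_zero]
  linarith
end

section
/- Let w_1, ..., w_n > 0, λ ≥ 0, and let r_1, ..., r_n be nonzero real numbers, and define g(t) = Σ_{i=1}^n w_i |r_i − t| + λ|t|. If λ ≥ | Σ_{i : r_i < 0} w_i − Σ_{i : r_i > 0} w_i |, then t = 0 is a global minimizer of g over R, and g(0) = Σ_{i=1}^n w_i |r_i|. -/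
open Finset

/-- For positive weights `w`, penalty `λ ≥ 0`, and nonzero values
`r_i`, if `λ ≥ |Σ_{i : r_i < 0} w_i − Σ_{i : r_i > 0} w_i|`, then `t = 0` is a
global minimizer of `g(t) = Σ_i w_i |r_i − t| + λ|t|`, and
`g(0) = Σ_i w_i |r_i|`. -/
theorem zero_optimal_of_large_penalty
    (n : ℕ) (w r : Fin n → ℝ) (hw : ∀ i, 0 < w i) (lam : ℝ) (hlam : 0 ≤ lam)
    (hr : ∀ i, r i ≠ 0)
    (hbig : |(∑ i ∈ univ.filter (fun i => r i < 0), w i)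
           - (∑ i ∈ univ.filter (fun i => 0 < r i), w i)| ≤ lam) :
    (∀ t : ℝ,
      (∑ i, w i * |r i - 0|) + lam * |(0 : ℝ)| ≤ (∑ i, w i * |r i - t|) + lam * |t|) ∧
    (∑ i, w i * |r i - 0|) + lam * |(0 : ℝ)| = ∑ i, w i * |r i| := by
  refine ⟨fun t => ?_, by simp⟩
  rw [sum_filter, sum_filter, ← sum_sub_distrib] at hbig
  have subgradient : ∑ i, w i * |r i| +
      t * ∑ i, ((if r i < 0 then w i else 0) - (if 0 < r i then w i else 0))
      ≤ ∑ i, w i * |r i - t| := by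
    rw [mul_sum, ← sum_add_distrib]
    refine sum_le_sum fun i _ => ?_
    rcases lt_or_gt_of_ne (hr i) with h | h
    · rw [if_pos h, if_neg h.not_gt, abs_of_neg h]
      nlinarith [mul_le_mul_of_nonneg_left (neg_le_abs (r i - t)) (hw i).le]
    · rw [if_neg h.not_gt, if_pos h, abs_of_pos h]
      nlinarith [mul_le_mul_of_nonneg_left (le_abs_self (r i - t)) (hw i).le]
  set d := ∑ i, ((if r i < 0 then w i else 0) - (if 0 < r i then w i else 0))
  have penalty : -(lam * |t|) ≤ t * d := by
    have h := neg_abs_le (t * d)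
    rw [abs_mul] at h
    linarith [mul_le_mul_of_nonneg_left hbig (abs_nonneg t), mul_comm lam |t|]
  simp only [sub_zero, abs_zero, mul_zero, add_zero]
  linarith
end

section
/- Let w_1, ..., w_n > 0, λ ≥ 0, and let r_1 ≤ r_2 ≤ ... ≤ r_n be real numbers. Suppose index ĩ satisfies | sgn(r_ĩ) λ + Σ_{i < ĩ} w_i − Σ_{i > ĩ} w_i | ≤ w_ĩ. Define γ = −sgn(r_ĩ) λ, π_i = w_i for i > ĩ, π_i = −w_i for i < ĩ, and π_ĩ = −γ − Σ_{i ≠ ĩ} π_i. Then (π, γ) is dual feasible (i.e., Σ_i π_i + γ = 0, |π_i| ≤ w_i for all i, |γ| ≤ λ) and its dual objective attains the primal value: Σ_{i=1}^n r_i π_i = Σ_{i=1}^n w_i |r_i − r_ĩ| + λ |r_ĩ|. -/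
open Finset

/-- Under the optimality condition at index `itil`, the dual solution
`γ = −sgn(r_itil) λ`, `π_i = w_i` for `i > itil`, `π_i = −w_i` for `i < itil`,
`π_itil = −γ − Σ_{i ≠ itil} π_i` is dual feasible and its dual objective equals the
primal value at `t = r_itil`. -/
theorem dual_solution_feasible_and_tight
    (n : ℕ) (w r : Fin n → ℝ) (hw : ∀ i, 0 < w i) (lam : ℝ) (hlam : 0 ≤ lam)
    (hsort : Monotone r) (itil : Fin n)
    (hcond : |Real.sign (r itil) * lam
        + (∑ i ∈ univ.filter (fun i => i < itil), w i)
        - (∑ i ∈ univ.filter (fun i => itil < i), w i)| ≤ w itil)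
    (γ : ℝ) (hγdef : γ = -(Real.sign (r itil)) * lam)
    (π : Fin n → ℝ)
    (hπgt : ∀ i, itil < i → π i = w i)
    (hπlt : ∀ i, i < itil → π i = -w i)
    (hπitil : π itil = -γ - ∑ i ∈ univ.erase itil, π i) :
    ((∑ i, π i) + γ = 0 ∧ (∀ i, |π i| ≤ w i) ∧ |γ| ≤ lam) ∧
    (∑ i, r i * π i) = (∑ i, w i * |r i - r itil|) + lam * |r itil| := by
  have hsum : (∑ i, π i) + γ = 0 := by
    rw [← add_sum_erase univ π (mem_univ itil), hπitil]
    ring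
  have herase : ∑ i ∈ univ.erase itil, π i
      = (∑ i ∈ univ.filter (fun i => itil < i), w i)
        - ∑ i ∈ univ.filter (fun i => i < itil), w i := by
    rw [sum_filter, sum_filter, ← sum_sub_distrib]
    refine (sum_congr rfl fun i hi => ?_).trans (sum_erase (a := itil) univ (by simp))
    rcases lt_or_gt_of_ne (ne_of_mem_erase hi) with h | h
    · simp [h, h.not_gt, hπlt i h]
    · simp [h, h.not_gt, hπgt i h]
  have hsign : |Real.sign (r itil)| ≤ 1 := by
    rcases Real.sign_apply_eq (r itil) with h | h | h <;> simp [h]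
  refine ⟨⟨hsum, fun i => ?_, ?_⟩, ?_⟩
  · rcases lt_trichotomy i itil with h | rfl | h
    · rw [hπlt i h, abs_neg, abs_of_pos (hw i)]
    · rw [hπitil, herase, hγdef]
      convert hcond using 2
      ring
    · rw [hπgt i h, abs_of_pos (hw i)]
  · rw [hγdef, abs_mul, abs_neg, abs_of_nonneg hlam]
    exact mul_le_of_le_one_left hlam hsign
  · have hterm : ∀ i, w i * |r i - r itil| = r i * π i - r itil * π i := by
      intro i
      rcases lt_trichotomy i itil with h | rfl | h
      · rw [hπlt i h, abs_of_nonpos (sub_nonpos.2 (hsort h.le))]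
        ring
      · simp
      · rw [hπgt i h, abs_of_nonneg (sub_nonneg.2 (hsort h.le))]
        ring
    have habs : Real.sign (r itil) * r itil = |r itil| := by
      rcases lt_trichotomy (r itil) 0 with h | h | h
      · simp [Real.sign_of_neg h, abs_of_neg h]
      · simp [h]
      · simp [Real.sign_of_pos h, abs_of_pos h]
    rw [sum_congr rfl fun i _ => hterm i, sum_sub_distrib, ← mul_sum,
      eq_neg_of_add_eq_zero_left hsum, hγdef, ← habs]
    ring
end

section
/- Let x_1, ..., x_n ∈ R^m, λ ≥ 0, and fix a coordinate ĵ ∈ {1,...,m}. Define v* ∈ R^m by v*_ĵ = 1 and, for each j ≠ ĵ, v*_j equal to a global minimizer in {0} ∪ {x_{ij}/x_{iĵ} : x_{iĵ} ≠ 0} of the function t ↦ Σ_{i=1}^n |x_{ij} − t x_{iĵ}| + λ|t|. Then v* attains the minimum of Σ_{i=1}^n Σ_{j=1}^m |x_{ij} − v_j x_{iĵ}| + λ Σ_{j=1}^m |v_j| over all v ∈ R^m with v_ĵ = 1. -/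
/-- A nonempty finite set containing every breakpoint of the convex piecewise linear function
`t ↦ ∑ k, |a k - t * b k|` contains a global minimizer of it. -/
theorem exists_mem_sum_abs_sub_mul_le {ι : Type*} [Fintype ι] (a b : ι → ℝ) (S : Finset ℝ)
    (hS : S.Nonempty) (h : ∀ k, b k ≠ 0 → a k / b k ∈ S) (t : ℝ) :
    ∃ s ∈ S, ∑ k, |a k - s * b k| ≤ ∑ k, |a k - t * b k| := by
  have key (k : ι) : b k = 0 ∨ ∃ c ∈ S, ∀ s, |a k - s * b k| = |b k| * |c - s| := by
    by_cases hb : b k = 0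
    · exact .inl hb
    · refine .inr ⟨_, h k hb, fun s => ?_⟩
      rw [← abs_mul]
      congr 1
      field_simp
  by_cases hlo : ∃ s ∈ S, s ≤ t
  · obtain ⟨p, hp, hpmax⟩ := (S.filter (· ≤ t)).exists_max_image id
      (by simpa [Finset.Nonempty] using hlo)
    simp only [Finset.mem_filter, id, and_imp] at hp hpmax
    by_cases hhi : ∃ s ∈ S, t < s
    · obtain ⟨q, hq, hqmin⟩ := (S.filter (t < ·)).exists_min_image id
        (by simpa [Finset.Nonempty] using hhi)
      simp only [Finset.mem_filter, id, and_imp] at hq hqmin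
      have hconv : (q - t) * ∑ k, |a k - p * b k| + (t - p) * ∑ k, |a k - q * b k| ≤
          (q - p) * ∑ k, |a k - t * b k| := by
        simp only [Finset.mul_sum]
        rw [← Finset.sum_add_distrib]
        refine Finset.sum_le_sum fun k _ => le_of_eq ?_
        rcases key k with hb | ⟨c, hc, hk⟩
        · simp only [hb, mul_zero, sub_zero]
          ring
        · rw [hk, hk, hk]
          generalize |b k| = β
          rcases le_or_gt c t with hct | hct
          · have := hpmax c hc hct
            rw [abs_of_nonpos (by linarith), abs_of_nonpos (by linarith),
              abs_of_nonpos (by linarith)]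
            ring
          · have := hqmin c hc hct
            rw [abs_of_nonneg (by linarith), abs_of_nonneg (by linarith),
              abs_of_nonneg (by linarith)]
            ring
      by_contra! hcon
      have h1 := hcon p hp.1
      have h2 := hcon q hq.1
      nlinarith [mul_pos (sub_pos.2 hq.2) (sub_pos.2 h1),
        mul_nonneg (sub_nonneg.2 hp.2) (sub_pos.2 h2).le]
    · push Not at hhi
      refine ⟨p, hp.1, Finset.sum_le_sum fun k _ => ?_⟩
      rcases key k with hb | ⟨c, hc, hk⟩
      · simp [hb]
      · have := hpmax c hc (hhi c hc)
        rw [hk, hk]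
        refine mul_le_mul_of_nonneg_left ?_ (abs_nonneg _)
        rw [abs_of_nonpos (by linarith), abs_of_nonpos (by linarith)]
        linarith
  · push Not at hlo
    obtain ⟨q, hq, hqmin⟩ := S.exists_min_image id hS
    simp only [id] at hqmin
    refine ⟨q, hq, Finset.sum_le_sum fun k _ => ?_⟩
    rcases key k with hb | ⟨c, hc, hk⟩
    · simp [hb]
    · have := hqmin c hc
      have := hlo q hq
      rw [hk, hk]
      refine mul_le_mul_of_nonneg_left ?_ (abs_nonneg _)
      rw [abs_of_nonneg (by linarith), abs_of_nonneg (by linarith)]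
      linarith


/-- If `v*` has `v*_jhat = 1` and, for each `j ≠ jhat`, `v*_j` is a
global minimizer within the candidate set `{0} ∪ {x_{ij}/x_{ijhat} : x_{ijhat} ≠ 0}`
of `t ↦ Σ_i |x_{ij} − t x_{ijhat}| + λ|t|`, then `v*` minimizes the
coordinate-preserving regularized objective over all `v` with `v_jhat = 1`. -/
theorem separable_minimizers_give_optimal_line
    (n m : ℕ) (x : Fin n → Fin m → ℝ) (lam : ℝ) (hlam : 0 ≤ lam)
    (jhat : Fin m) (vstar : Fin m → ℝ) (hjhat : vstar jhat = 1)
    (hmem : ∀ j, j ≠ jhat →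
      vstar j = 0 ∨ ∃ i, x i jhat ≠ 0 ∧ vstar j = x i j / x i jhat)
    (hmin : ∀ j, j ≠ jhat → ∀ t : ℝ,
      (t = 0 ∨ ∃ i, x i jhat ≠ 0 ∧ t = x i j / x i jhat) →
      (∑ i, |x i j - vstar j * x i jhat|) + lam * |vstar j| ≤
        (∑ i, |x i j - t * x i jhat|) + lam * |t|) :
    ∀ v : Fin m → ℝ, v jhat = 1 →
      (∑ i, ∑ j, |x i j - vstar j * x i jhat|) + lam * ∑ j, |vstar j| ≤
      (∑ i, ∑ j, |x i j - v j * x i jhat|) + lam * ∑ j, |v j| := by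
  intro v hv
  rw [Finset.sum_comm, Finset.sum_comm (f := fun i j => |x i j - v j * x i jhat|),
    Finset.mul_sum, Finset.mul_sum, ← Finset.sum_add_distrib, ← Finset.sum_add_distrib]
  refine Finset.sum_le_sum fun j _ => ?_
  by_cases hj : j = jhat
  · subst hj
    rw [hjhat, hv]
  classical
  obtain ⟨s, hs, hle⟩ := exists_mem_sum_abs_sub_mul_le
    (fun k : Option (Fin n) => k.elim 0 fun i => x i j)
    (fun k : Option (Fin n) => k.elim lam fun i => x i jhat)
    (insert 0 ((Finset.univ.filter fun i => x i jhat ≠ 0).image fun i => x i j / x i jhat))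
    (Finset.insert_nonempty _ _)
    (by
      rintro (_ | i) hk
      · simp
      · exact Finset.mem_insert_of_mem
          (Finset.mem_image_of_mem _ (Finset.mem_filter.2 ⟨Finset.mem_univ i, hk⟩)))
    (v j)
  simp only [Fintype.sum_option, Option.elim, zero_sub, abs_neg, abs_mul,
    abs_of_nonneg hlam] at hle
  have hcand : s = 0 ∨ ∃ i, x i jhat ≠ 0 ∧ s = x i j / x i jhat := by
    simpa [eq_comm] using hs
  linarith [hmin j hj s hcand]
end
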